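/- (Remark 3.3, relaxed GRK without momentum.) Let A ∈ ℝ^{m×n} have nonzero rows, let Ax = b be consistent, x⁰ ∈ ℝⁿ, x* = A†b + (I − A†A)x⁰, θ ∈ [0,1], and α ∈ (0,2). Let (x^k) be generated by the relaxed GRK iteration: at each step Ax^k ≠ b, Γ_k = Γ(x^k), an arbitrary i_k is chosen from S_k = {i : |⟨a_i,x^k⟩ − b_i|²/‖a_i‖₂² ≥ θ·max_{j∈[m]} |⟨a_j,x^k⟩ − b_j|²/‖a_j‖₂² + (1−θ)·‖Ax^k − b‖₂²/Γ_k}, and x^{k+1} = x^k − α((⟨a_{i_k},x^k⟩ − b_{i_k})/‖a_{i_k}‖₂²)a_{i_k}. Then for all k ≥ 0, ‖x^k − x*‖₂² ≤ (1 − (2α − α²)·σ_min²(A)/‖A‖_F²)^k · ‖x⁰ − x*‖₂². -/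

import Mathlib

open scoped RealInnerProductSpace BigOperators

/-- A relaxed projection step of `e` against `v` with relaxation parameter `α`. -/
lemma norm_sub_relaxed_projection_sq {E : Type*} [NormedAddCommGroup E] [InnerProductSpace ℝ E]
    (e v : E) (hv : v ≠ 0) (α : ℝ) :
    ‖e - α • ((⟪v, e⟫ / ‖v‖ ^ 2) • v)‖ ^ 2 =
      ‖e‖ ^ 2 - (2 * α - α ^ 2) * (⟪v, e⟫ ^ 2 / ‖v‖ ^ 2) := by
  have hv' : ‖v‖ ≠ 0 := norm_ne_zero_iff.mpr hv
  rw [norm_sub_sq_real, smul_smul, inner_smul_right, norm_smul, mul_pow, Real.norm_eq_abs, sq_abs,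
    real_inner_comm v e]
  field_simp
  ring

/-- The greedy threshold dominates the average of the squared residuals `r j ^ 2` with respect to
the full weight `∑ j, w j`. -/
lemma sum_sq_div_sum_le_greedy_threshold {ι : Type*} [Fintype ι] [Nonempty ι]
    (r w : ι → ℝ) (hw : ∀ j, 0 < w j) (p : ι → Prop) [DecidablePred p] (hp : ∃ j, p j)
    (θ : ℝ) (hθ0 : 0 ≤ θ) (hθ1 : θ ≤ 1) :
    (∑ j, r j ^ 2) / ∑ j, w j ≤
      θ * (Finset.univ.sup' Finset.univ_nonempty fun j => r j ^ 2 / w j) +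
        (1 - θ) * ((∑ j, r j ^ 2) / ∑ j ∈ Finset.univ.filter p, w j) := by
  have hW : 0 < ∑ j, w j := Finset.sum_pos (fun j _ => hw j) Finset.univ_nonempty
  obtain ⟨j₀, hj₀⟩ := hp
  have hΓ : 0 < ∑ j ∈ Finset.univ.filter p, w j :=
    Finset.sum_pos (fun j _ => hw j) ⟨j₀, by simpa using hj₀⟩
  have hΓW : ∑ j ∈ Finset.univ.filter p, w j ≤ ∑ j, w j :=
    Finset.sum_le_sum_of_subset_of_nonneg (Finset.filter_subset _ _) fun j _ _ => (hw j).le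
  have hmax : (∑ j, r j ^ 2) / ∑ j, w j ≤
      Finset.univ.sup' Finset.univ_nonempty fun j => r j ^ 2 / w j := by
    rw [div_le_iff₀ hW, Finset.mul_sum]
    refine Finset.sum_le_sum fun j _ => (div_le_iff₀ (hw j)).mp ?_
    exact Finset.le_sup' (fun j => r j ^ 2 / w j) (Finset.mem_univ j)
  have havg : (∑ j, r j ^ 2) / ∑ j, w j ≤
      (∑ j, r j ^ 2) / ∑ j ∈ Finset.univ.filter p, w j :=
    div_le_div_of_nonneg_left (Finset.sum_nonneg fun j _ => sq_nonneg _) hΓ hΓW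
  have h1 := mul_le_mul_of_nonneg_left hmax hθ0
  have h2 := mul_le_mul_of_nonneg_left havg (sub_nonneg.mpr hθ1)
  linarith

/-- Remark 3.3: relaxed GRK without momentum.  For `θ ∈ [0,1]` and
step-size `α ∈ (0,2)`, the relaxed GRK iterates satisfy
`‖x^k - xs‖² ≤ (1 - (2α - α²)σ²/‖A‖_F²)^k ‖x⁰ - xs‖²`.  The projection
`xs = A†b + (I - A†A)x⁰` is encoded by `⟪a i, xs⟫ = b i` and
`x 0 - xs ∈ Range(Aᵀ) = span {a₁,…,a_m}`; the smallest nonzero singular value `σ`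
by `σ > 0` and `σ²‖z‖² ≤ ∑ i ⟪a i, z⟫²` for `z ∈ Range(Aᵀ)`. -/
theorem relaxed_GRK_convergence {m n : ℕ} [Nonempty (Fin m)]
    (a : Fin m → EuclideanSpace ℝ (Fin n)) (b : Fin m → ℝ)
    (ha : ∀ i, a i ≠ 0)
    (xs : EuclideanSpace ℝ (Fin n)) (hxs : ∀ i, ⟪a i, xs⟫ = b i)
    (σ : ℝ) (hσpos : 0 < σ)
    (hσ : ∀ z ∈ Submodule.span ℝ (Set.range a), σ ^ 2 * ‖z‖ ^ 2 ≤ ∑ i, ⟪a i, z⟫ ^ 2)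
    (θ α : ℝ) (hθ0 : 0 ≤ θ) (hθ1 : θ ≤ 1) (hα0 : 0 < α) (hα2 : α < 2)
    (x : ℕ → EuclideanSpace ℝ (Fin n))
    (hx0 : x 0 - xs ∈ Submodule.span ℝ (Set.range a))
    (idx : ℕ → Fin m)
    (hne : ∀ k : ℕ, ∃ i, ⟪a i, x k⟫ ≠ b i)
    (hik : ∀ k : ℕ,
      (⟪a (idx k), x k⟫ - b (idx k)) ^ 2 / ‖a (idx k)‖ ^ 2 ≥
        θ * (Finset.univ.sup' Finset.univ_nonempty fun j => (⟪a j, x k⟫ - b j) ^ 2 / ‖a j‖ ^ 2) +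
          (1 - θ) *
            ((∑ j, (⟪a j, x k⟫ - b j) ^ 2) /
              (∑ j ∈ Finset.univ.filter (fun j => ⟪a j, x k⟫ ≠ b j), ‖a j‖ ^ 2)))
    (hrec : ∀ k : ℕ,
      x (k + 1) =
        x k - α • (((⟪a (idx k), x k⟫ - b (idx k)) / ‖a (idx k)‖ ^ 2) • a (idx k))) :
    ∀ k : ℕ,
      ‖x k - xs‖ ^ 2 ≤
        (1 - (2 * α - α ^ 2) * σ ^ 2 / ∑ i, ‖a i‖ ^ 2) ^ k * ‖x 0 - xs‖ ^ 2 := by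
  have hres : ∀ k i, ⟪a i, x k⟫ - b i = ⟪a i, x k - xs⟫ := fun k i => by
    rw [inner_sub_right, hxs]
  have hstep : ∀ k, x (k + 1) - xs = (x k - xs) -
      α • ((⟪a (idx k), x k - xs⟫ / ‖a (idx k)‖ ^ 2) • a (idx k)) := fun k => by
    rw [hrec, hres]
    abel
  have hmem : ∀ k, x k - xs ∈ Submodule.span ℝ (Set.range a) := by
    intro k
    induction k with
    | zero => exact hx0
    | succ k ih =>
      rw [hstep]
      exact sub_mem ih (Submodule.smul_mem _ _ (Submodule.smul_mem _ _
        (Submodule.subset_span (Set.mem_range_self _))))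
  have hw : ∀ j, 0 < ‖a j‖ ^ 2 := fun j => pow_pos (norm_pos_iff.mpr (ha j)) 2
  have hF : 0 < ∑ j, ‖a j‖ ^ 2 := Finset.sum_pos (fun j _ => hw j) Finset.univ_nonempty
  have hα : 0 ≤ 2 * α - α ^ 2 := by nlinarith
  have hcontract : ∀ k, ‖x (k + 1) - xs‖ ^ 2 ≤
      (1 - (2 * α - α ^ 2) * σ ^ 2 / ∑ i, ‖a i‖ ^ 2) * ‖x k - xs‖ ^ 2 := by
    intro k
    have hgreedy := (sum_sq_div_sum_le_greedy_threshold (fun j => ⟪a j, x k⟫ - b j)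
      (fun j => ‖a j‖ ^ 2) hw (fun j => ⟪a j, x k⟫ ≠ b j) (hne k) θ hθ0 hθ1).trans (hik k)
    simp only [hres] at hgreedy
    have hle := (div_le_div_of_nonneg_right (hσ _ (hmem k)) hF.le).trans hgreedy
    have hmul := mul_le_mul_of_nonneg_left hle hα
    rw [hstep, norm_sub_relaxed_projection_sq _ _ (ha _)]
    calc _ ≤ ‖x k - xs‖ ^ 2 -
          (2 * α - α ^ 2) * (σ ^ 2 * ‖x k - xs‖ ^ 2 / ∑ i, ‖a i‖ ^ 2) := by linarith
      _ = _ := by ring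
  have hrate : 0 ≤ 1 - (2 * α - α ^ 2) * σ ^ 2 / ∑ i, ‖a i‖ ^ 2 := by
    obtain ⟨i, hi⟩ := hne 0
    have hpos : 0 < ‖x 0 - xs‖ ^ 2 := by
      refine pow_pos (norm_pos_iff.mpr fun h => hi ?_) 2
      rw [sub_eq_zero.mp h, hxs]
    exact nonneg_of_mul_nonneg_left ((sq_nonneg _).trans (hcontract 0)) hpos
  intro k
  induction k with
  | zero => simp
  | succ k ih =>
    rw [pow_succ' _ k, mul_assoc]
    exact (hcontract k).trans (mul_le_mul_of_nonneg_left ih hrate)
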